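/- For all n ∈ ℕ with n ≥ 1 and all x ∈ {0,1}^n with x ≠ e^n, there is exactly one k ∈ {1,…,n} such that either ∂_k F_n(x) > 0 and x_k = 0, or ∂_k F_n(x) < 0 and x_k = 1. -/

import Mathlib

open Finset

/-- `alphaF n x i` is the recursively defined `α_{n,i}(x)`:
`α_{n,n+1}(x) = 0` and `α_{n,i}(x) = x_i + (1 - 2 x_i) α_{n,i+1}(x)` for `i = 1, …, n`. -/
noncomputable def alphaF (n : ℕ) (x : ℕ → ℝ) (i : ℕ) : ℝ :=
  if h : n + 1 ≤ i then 0 else x i + (1 - 2 * x i) * alphaF n x (i + 1)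
termination_by n + 1 - i
decreasing_by omega

/-- `betaF n x i = 2^i (x_i - x_i²)(1 - x_{i-1} + Σ_{j=1}^{i-2} x_j)`, with `x_0 := 1`. -/
noncomputable def betaF (n : ℕ) (x : ℕ → ℝ) (i : ℕ) : ℝ :=
  (2 : ℝ) ^ i * (x i - x i ^ 2) *
    (1 - (if i = 1 then 1 else x (i - 1)) + ∑ j ∈ Finset.Icc 1 (i - 2), x j)

/-- `Ffun n x = Σ_{i=1}^n (2^{i-1} α_{n,i}(x) - β_{n,i}(x))`. -/
noncomputable def Ffun (n : ℕ) (x : ℕ → ℝ) : ℝ :=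
  ∑ i ∈ Finset.Icc 1 n, ((2 : ℝ) ^ (i - 1) * alphaF n x i - betaF n x i)

/-- `partialF n k x` is the partial derivative `∂_k F_n(x)`. -/
noncomputable def partialF (n k : ℕ) (x : ℕ → ℝ) : ℝ :=
  deriv (fun t => Ffun n (Function.update x k t)) (x k)

/-- `partialAlpha n k i x` is the partial derivative `∂_k α_{n,i}(x)`. -/
noncomputable def partialAlpha (n k i : ℕ) (x : ℕ → ℝ) : ℝ :=
  deriv (fun t => alphaF n (Function.update x k t) i) (x k)

/-- `Pfun n x k = x_{k-1} ∏_{j=1}^{k-2} (1 - x_j)`, with `x_0 := 1`. -/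
noncomputable def Pfun (n : ℕ) (x : ℕ → ℝ) (k : ℕ) : ℝ :=
  (if k = 1 then 1 else x (k - 1)) * ∏ j ∈ Finset.Icc 1 (k - 2), (1 - x j)

/-- `Sfun n x k = Σ_{j=k+1}^n x_j`. -/
noncomputable def Sfun (n : ℕ) (x : ℕ → ℝ) (k : ℕ) : ℝ :=
  ∑ j ∈ Finset.Icc (k + 1) n, x j

/-- Two real numbers (which will take integer values) have the same parity. -/
def SameParity (a b : ℝ) : Prop := ∃ m : ℤ, a - b = 2 * (m : ℝ)

/-- The `k`-th standard unit vector, as a function `ℕ → ℝ` (coordinates `1, …, n`). -/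
noncomputable def unitVec (k : ℕ) : ℕ → ℝ := fun i => if i = k then 1 else 0


lemma aux_alpha_top (n : ℕ) (x : ℕ → ℝ) (i : ℕ) (h : n < i) : alphaF n x i = 0 := by
  rw [alphaF, dif_pos (by omega)]

lemma aux_alpha_step (n : ℕ) (x : ℕ → ℝ) (i : ℕ) (h : i ≤ n) :
    alphaF n x i = x i + (1 - 2 * x i) * alphaF n x (i + 1) := by
  rw [alphaF, dif_neg (by omega)]

lemma aux_alpha_gt (n : ℕ) (x : ℕ → ℝ) (k : ℕ) (t : ℝ) (d : ℕ) :
    ∀ i, k < i → n + 1 - i = d → alphaF n (Function.update x k t) i = alphaF n x i := by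
  induction d with
  | zero => intro i _ hd; rw [aux_alpha_top _ _ _ (by omega), aux_alpha_top _ _ _ (by omega)]
  | succ d ih =>
    intro i hi hd
    rw [aux_alpha_step _ _ _ (by omega), aux_alpha_step n x _ (by omega),
      ih (i+1) (by omega) (by omega), Function.update_of_ne (by omega)]

/-- product of signs -/
noncomputable def auxC (x : ℕ → ℝ) (i k : ℕ) : ℝ := ∏ j ∈ Finset.Ico i k, (1 - 2 * x j)

lemma aux_alpha_le (n : ℕ) (x : ℕ → ℝ) (k : ℕ) (hk : k ≤ n) (t : ℝ) (d : ℕ) :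
    ∀ i, i + d = k → alphaF n (Function.update x k t) i =
      alphaF n x i + (t - x k) * (auxC x i k * (1 - 2 * alphaF n x (k+1))) := by
  induction d with
  | zero =>
    intro i hi
    obtain rfl : i = k := by omega
    rw [aux_alpha_step _ _ _ hk, aux_alpha_step n x _ hk, aux_alpha_gt n x i t _ _ (by omega) rfl]
    simp [auxC]; ring
  | succ d ih =>
    intro i hi
    rw [aux_alpha_step _ _ _ (by omega), aux_alpha_step n x i (by omega),
      ih (i+1) (by omega), Function.update_of_ne (by omega)]
    have : auxC x i k = (1 - 2 * x i) * auxC x (i+1) k := by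
      unfold auxC; rw [Finset.prod_eq_prod_Ico_succ_bot (by omega)]
    rw [this]; ring

noncomputable def auxB (x : ℕ → ℝ) (i : ℕ) : ℝ :=
  (1 - (if i = 1 then 1 else x (i - 1)) + ∑ j ∈ Finset.Icc 1 (i - 2), x j)

lemma aux_beta (n : ℕ) (x : ℕ → ℝ) (hx : ∀ i ∈ Finset.Icc 1 n, x i = 0 ∨ x i = 1)
    (k : ℕ) (hk : k ∈ Finset.Icc 1 n) (t : ℝ) (i : ℕ) (hi : i ∈ Finset.Icc 1 n) :
    betaF n (Function.update x k t) i = if i = k then 2 ^ k * (t - t^2) * auxB x k else 0 := by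
  simp only [Finset.mem_Icc] at hk hi
  split_ifs with h
  · subst h
    unfold betaF auxB
    rw [Function.update_self, Function.update_of_ne (by omega)]
    congr 2
    apply Finset.sum_congr rfl
    intro j hj
    simp only [Finset.mem_Icc] at hj
    rw [Function.update_of_ne (by omega)]
  · unfold betaF
    rw [Function.update_of_ne h]
    rcases hx i (by simp; omega) with h | h <;> simp [h]

noncomputable def auxT (x : ℕ → ℝ) (k : ℕ) : ℝ :=
  ∑ i ∈ Finset.Icc 1 k, (2:ℝ)^(i-1) * auxC x i k

lemma aux_F (n : ℕ) (x : ℕ → ℝ) (hx : ∀ i ∈ Finset.Icc 1 n, x i = 0 ∨ x i = 1)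
    (k : ℕ) (hk : k ∈ Finset.Icc 1 n) (t : ℝ) :
    Ffun n (Function.update x k t) = (∑ i ∈ Finset.Icc 1 n, (2:ℝ)^(i-1) * alphaF n x i)
      + (t - x k) * (auxT x k * (1 - 2 * alphaF n x (k+1))) - 2 ^ k * (t - t^2) * auxB x k := by
  unfold Ffun
  rw [Finset.sum_sub_distrib, Finset.sum_congr rfl (aux_beta n x hx k hk t),
    Finset.sum_ite_eq' , if_pos hk]
  congr 1
  have hk' := Finset.mem_Icc.1 hk
  have : ∀ i ∈ Finset.Icc 1 n, (2:ℝ)^(i-1) * alphaF n (Function.update x k t) i =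
      (2:ℝ)^(i-1) * alphaF n x i + (if i ≤ k then (2:ℝ)^(i-1) * auxC x i k else 0) *
        ((t - x k) * (1 - 2 * alphaF n x (k+1))) := by
    intro i hi
    split_ifs with h
    · rw [aux_alpha_le n x k hk'.2 t (k - i) i (by omega)]; ring
    · rw [aux_alpha_gt n x k t _ i (by omega) rfl]; ring
  rw [Finset.sum_congr rfl this, Finset.sum_add_distrib, ← Finset.sum_mul, ← Finset.sum_filter]
  have h2 : (Finset.Icc 1 n).filter (fun i => i ≤ k) = Finset.Icc 1 k := by
    ext i; simp; omega
  rw [h2]; unfold auxT; ring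

lemma aux_partial (n : ℕ) (x : ℕ → ℝ) (hx : ∀ i ∈ Finset.Icc 1 n, x i = 0 ∨ x i = 1)
    (k : ℕ) (hk : k ∈ Finset.Icc 1 n) :
    partialF n k x = auxT x k * (1 - 2 * alphaF n x (k+1)) - 2 ^ k * (1 - 2 * x k) * auxB x k := by
  unfold partialF
  rw [funext (aux_F n x hx k hk)]
  apply HasDerivAt.deriv
  have h1 := ((((hasDerivAt_id (x k)).sub_const (x k)).mul_const
    (auxT x k * (1 - 2 * alphaF n x (k+1)))).const_add
      (∑ i ∈ Finset.Icc 1 n, (2:ℝ)^(i-1) * alphaF n x i)).sub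
    ((((hasDerivAt_id (x k)).sub ((hasDerivAt_id (x k)).pow 2)).const_mul ((2:ℝ)^k)).mul_const
      (auxB x k))
  convert h1 using 1
  · funext y; simp
  · simp

lemma aux_T_succ (x : ℕ → ℝ) (k : ℕ) : auxT x (k+1) = (1 - 2 * x k) * auxT x k + 2 ^ k := by
  unfold auxT
  rw [Finset.sum_Icc_succ_top (by omega), Finset.mul_sum]
  congr 1
  · apply Finset.sum_congr rfl
    intro i hi
    simp only [Finset.mem_Icc] at hi
    unfold auxC
    rw [Finset.prod_Ico_succ_top (by omega)]; ring
  · simp [auxC]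

lemma aux_T_one (x : ℕ → ℝ) : auxT x 1 = 1 := by simp [auxT, auxC]

lemma aux_T_bound (n : ℕ) (x : ℕ → ℝ) (hx : ∀ i ∈ Finset.Icc 1 n, x i = 0 ∨ x i = 1)
    (k : ℕ) (hk1 : 1 ≤ k) (hk : k ≤ n) : |auxT x k| < 2 ^ k := by
  induction k, hk1 using Nat.le_induction with
  | base => rw [aux_T_one]; norm_num
  | succ k h1 ih =>
    have ih := abs_lt.1 (ih (by omega))
    rw [aux_T_succ, pow_succ, abs_lt]
    rcases hx k (by simp; omega) with h | h <;> rw [h] <;> constructor <;> linarith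

lemma aux_T_zeros (x : ℕ → ℝ) (k : ℕ) (hk1 : 1 ≤ k) (h0 : ∀ j, 1 ≤ j → j < k → x j = 0) :
    auxT x k = 2 ^ k - 1 := by
  induction k, hk1 using Nat.le_induction with
  | base => rw [aux_T_one]; norm_num
  | succ k h1 ih =>
    rw [aux_T_succ, ih (fun j hj hj' => h0 j hj (by omega)), h0 k h1 (by omega)]; ring

/-- characterization of B = 0 -/
def auxZ (x : ℕ → ℝ) (k : ℕ) : Prop :=
  k = 1 ∨ (2 ≤ k ∧ x (k-1) = 1 ∧ ∀ j, 1 ≤ j → j < k - 1 → x j = 0)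

lemma aux_Z_B (x : ℕ → ℝ) (k : ℕ) (h : auxZ x k) : auxB x k = 0 ∧ auxT x k = 1 := by
  rcases h with rfl | ⟨h2, h1, h0⟩
  · simp [auxB, aux_T_one]
  · constructor
    · unfold auxB
      rw [if_neg (by omega), h1, Finset.sum_eq_zero]
      · ring
      · intro j hj
        simp only [Finset.mem_Icc] at hj
        exact h0 j hj.1 (by omega)
    · obtain ⟨m, rfl⟩ : ∃ m, k = m + 1 := ⟨k-1, by omega⟩
      simp only [Nat.add_sub_cancel] at h1 h0
      rw [aux_T_succ, aux_T_zeros x m (by omega) h0, h1]; ring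

lemma aux_nZ_B (n : ℕ) (x : ℕ → ℝ) (hx : ∀ i ∈ Finset.Icc 1 n, x i = 0 ∨ x i = 1)
    (k : ℕ) (hk : k ∈ Finset.Icc 1 n) (h : ¬ auxZ x k) : 1 ≤ auxB x k := by
  simp only [Finset.mem_Icc] at hk
  unfold auxZ at h
  push Not at h
  obtain ⟨hk1, h⟩ := h
  have h := h (by omega)
  unfold auxB
  rw [if_neg hk1]
  have hnn : ∀ j ∈ Finset.Icc 1 (k-2), 0 ≤ x j := by
    intro j hj
    simp only [Finset.mem_Icc] at hj
    rcases hx j (by simp; omega) with h | h <;> rw [h]; norm_num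
  rcases hx (k-1) (by simp; omega) with h' | h'
  · have := Finset.sum_nonneg hnn
    rw [h']; linarith
  · obtain ⟨j, hj1, hj2, hj⟩ := h h'
    have := Finset.single_le_sum hnn (show j ∈ Finset.Icc 1 (k-2) by simp; omega)
    rcases hx j (by simp; omega) with h | h
    · exact absurd h hj
    · rw [h'] ; linarith

lemma aux_a_step (n : ℕ) (x : ℕ → ℝ) (k : ℕ) (hk : k ≤ n) :
    1 - 2 * alphaF n x k = (1 - 2 * x k) * (1 - 2 * alphaF n x (k+1)) := by
  rw [aux_alpha_step n x k hk]; ring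

lemma aux_a_pm (n : ℕ) (x : ℕ → ℝ) (hx : ∀ i ∈ Finset.Icc 1 n, x i = 0 ∨ x i = 1) (d : ℕ) :
    ∀ k, 1 ≤ k → n + 1 - k = d → 1 - 2 * alphaF n x k = 1 ∨ 1 - 2 * alphaF n x k = -1 := by
  induction d with
  | zero => intro k _ hd; left; rw [aux_alpha_top _ _ _ (by omega)]; ring
  | succ d ih =>
    intro k h1 hd
    rw [aux_a_step n x k (by omega)]
    rcases hx k (by simp; omega) with h | h <;>
    rcases ih (k+1) (by omega) (by omega) with h' | h' <;> rw [h, h'] <;> norm_num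

lemma aux_cond (n : ℕ) (x : ℕ → ℝ) (hx : ∀ i ∈ Finset.Icc 1 n, x i = 0 ∨ x i = 1)
    (k : ℕ) (hk : k ∈ Finset.Icc 1 n) :
    ((0 < partialF n k x ∧ x k = 0) ∨ (partialF n k x < 0 ∧ x k = 1)) ↔
      auxZ x k ∧ 1 - 2 * alphaF n x k = 1 := by
  have hk' := Finset.mem_Icc.1 hk
  have hs := aux_a_step n x k hk'.2
  have hp := aux_partial n x hx k hk
  have hpm := aux_a_pm n x hx _ k hk'.1 rfl
  have h1 : ((0 < partialF n k x ∧ x k = 0) ∨ (partialF n k x < 0 ∧ x k = 1)) ↔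
      0 < auxT x k * (1 - 2 * alphaF n x k) - 2 ^ k * auxB x k := by
    rw [hs, hp]
    rcases hx k hk with h | h
    · simp [h]
    · simp only [h, one_ne_zero, and_false, and_true, false_or]
      constructor <;> intro h <;> linarith
  rw [h1]
  by_cases hZ : auxZ x k
  · obtain ⟨hB, hT⟩ := aux_Z_B x k hZ
    rw [hB, hT]
    rcases hpm with h | h <;> rw [h] <;> simp [hZ] <;> norm_num
  · have hB := aux_nZ_B n x hx k hk hZ
    have hT := abs_lt.1 (aux_T_bound n x hx k hk'.1 hk'.2)
    have hp2 : (2:ℝ)^k ≤ 2^k * auxB x k := le_mul_of_one_le_right (by positivity) hB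
    simp only [hZ, false_and, iff_false, not_lt]
    rcases hpm with h | h <;> rw [h] <;> linarith

lemma aux_a_zeros (n : ℕ) (x : ℕ → ℝ) (m : ℕ) (hm1 : 1 ≤ m) (hm : m ≤ n + 1)
    (h0 : ∀ j, 1 ≤ j → j < m → x j = 0) : alphaF n x 1 = alphaF n x m := by
  induction m, hm1 using Nat.le_induction with
  | base => rfl
  | succ k h1 ih =>
    rw [ih (by omega) (fun j hj hj' => h0 j hj (by omega)), aux_alpha_step n x k (by omega),
      h0 k h1 (by omega)]; ring

theorem stmt10 (n : ℕ) (hn : 1 ≤ n) (x : ℕ → ℝ)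
    (hx : ∀ i ∈ Finset.Icc 1 n, x i = 0 ∨ x i = 1)
    (hne : ∃ i ∈ Finset.Icc 1 n, x i ≠ unitVec n i) :
    ∃! k, k ∈ Finset.Icc 1 n ∧
      ((0 < partialF n k x ∧ x k = 0) ∨ (partialF n k x < 0 ∧ x k = 1)) := by
  have key : ∀ k, (k ∈ Finset.Icc 1 n ∧
      ((0 < partialF n k x ∧ x k = 0) ∨ (partialF n k x < 0 ∧ x k = 1))) ↔
      (k ∈ Finset.Icc 1 n ∧ auxZ x k ∧ 1 - 2 * alphaF n x k = 1) :=
    fun k => and_congr_right (fun hk => aux_cond n x hx k hk)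
  simp only [key]
  -- after a first one at position m, the sign flips
  have flip : ∀ m, 1 ≤ m → m ≤ n → x m = 1 → (∀ j, 1 ≤ j → j < m → x j = 0) →
      1 - 2 * alphaF n x (m+1) = -(1 - 2 * alphaF n x 1) := by
    intro m h1 hmn hm h0
    rw [aux_a_zeros n x m h1 (by omega) h0, aux_a_step n x m hmn, hm]; ring
  rcases aux_a_pm n x hx _ 1 le_rfl rfl with ha | ha
  · refine ⟨1, ⟨by simp; omega, Or.inl rfl, ha⟩, ?_⟩
    rintro k ⟨hk, hZ, hak⟩
    simp only [Finset.mem_Icc] at hk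
    rcases hZ with h | ⟨h2, h1, h0⟩
    · exact h
    · exfalso
      have := flip (k-1) (by omega) (by omega) h1 h0
      rw [show k - 1 + 1 = k by omega] at this
      linarith
  · have hex : ∃ m, 1 ≤ m ∧ m ≤ n ∧ x m = 1 := by
      by_contra hcon
      push Not at hcon
      have := aux_a_zeros n x (n+1) (by omega) le_rfl (fun j h1 h2 =>
        (hx j (by simp; omega)).resolve_right (hcon j h1 (by omega)))
      rw [aux_alpha_top n x (n+1) (by omega)] at this
      rw [this] at ha
      norm_num at ha
    classical
    obtain ⟨h1, hmn, hm⟩ := Nat.find_spec hex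
    have hmin : ∀ j, 1 ≤ j → j < Nat.find hex → x j = 0 := by
      intro j hj hj'
      have := Nat.find_min hex hj'
      refine (hx j (by simp; omega)).resolve_right (fun h => this ⟨hj, by omega, h⟩)
    generalize Nat.find hex = m at *
    have hlt : m < n := by
      rcases Nat.lt_or_ge m n with h | h
      · exact h
      · obtain rfl : m = n := by omega
        obtain ⟨i, hi, hi'⟩ := hne
        simp only [Finset.mem_Icc] at hi
        exfalso; apply hi'
        unfold unitVec
        split_ifs with h
        · rw [h, hm]
        · exact hmin i hi.1 (by omega)
    refine ⟨m+1, ⟨by simp; omega, Or.inr ⟨by omega, hm, hmin⟩, ?_⟩, ?_⟩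
    · rw [flip m h1 hmn hm hmin, ha]; ring
    · rintro k ⟨hk, hZ, hak⟩
      simp only [Finset.mem_Icc] at hk
      rcases hZ with rfl | ⟨h2, h1', h0⟩
      · linarith
      · rcases lt_trichotomy (k-1) m with h | h | h
        · have := hmin (k-1) (by omega) h
          rw [h1'] at this; norm_num at this
        · omega
        · have := h0 m h1 h
          rw [hm] at this; norm_num at this
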